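/- Under the Perron setup with the section-3 hypotheses (m ≥ (240r)² and ρ² ≥ m − 1 + 2/(ρ − 1)), and assuming additionally that G is non-bipartite, there is exactly one edge of G with both endpoints in U, say u₁u₂, and every vertex of W is adjacent to both u₁ and u₂; moreover x_u ≤ ((|W| + 2)/ρ) x_{u*} for every u ∈ U. -/

import Mathlib

section PerronSetup

variable {V : Type*} [Fintype V] [DecidableEq V]

/-- The number of neighbors of `w` inside the vertex set `S`. -/
def dIn (G : SimpleGraph V) [DecidableRel G.Adj] (S : Finset V) (w : V) : ℕ :=
  (G.neighborFinset w ∩ S).card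

/-- The quantity `f(w) = d_U(w) (x_{u*} - x_w) + (1/2) d_W(w) x_{u*}`. -/
noncomputable def fW (G : SimpleGraph V) [DecidableRel G.Adj] (U W : Finset V)
    (x : V → ℝ) (ustar : V) (w : V) : ℝ :=
  (dIn G U w : ℝ) * (x ustar - x w) + (1 / 2) * (dIn G W w : ℝ) * x ustar

/-- A weighted 0/1 matrix `a` on a vertex set split as `{u*} ∪ U ∪ W`, with a weight vector `x`
normalised to `1` at `u*`, satisfying the eigenvalue equations, the edge count, and the book bounds. -/
structure PerronSplit {V : Type*} (U W : Finset V) (a : V → V → ℝ) (x : V → ℝ)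
    (ρ m r : ℝ) : Prop where
  zero_or_one : ∀ u v, a u v = 0 ∨ a u v = 1
  symm : ∀ u v, a u v = a v u
  pos : ∀ v, 0 < x v
  le_one : ∀ v, x v ≤ 1
  eig_top : ρ = ∑ u ∈ U, x u
  eig_U : ∀ u ∈ U, ρ * x u = 1 + ∑ v ∈ U, a u v * x v + ∑ w ∈ W, a u w * x w
  eig_W : ∀ w ∈ W, ρ * x w = ∑ u ∈ U, a w u * x u + ∑ z ∈ W, a w z * x z
  edges : m = U.card + (∑ u ∈ U, ∑ v ∈ U, a u v) / 2 + ∑ u ∈ U, ∑ w ∈ W, a u w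
    + (∑ w ∈ W, ∑ z ∈ W, a w z) / 2
  degree_le : ∀ u ∈ U, ∑ v ∈ U, a u v ≤ r
  book : ∀ u ∈ U, ∀ v ∈ U, a u v = 1 → 1 + ∑ w ∈ W, a u w * a v w ≤ r
  one_le : 1 ≤ r
  large : 239 * r ≤ ρ
  edges_lt : m < ρ ^ 2 + 1

namespace PerronSplit

/-- The total deficiency of the vertices of `W`. -/
noncomputable def loss {V : Type*} (U W : Finset V) (a : V → V → ℝ) (x : V → ℝ) : ℝ :=
  ∑ w ∈ W, ((∑ u ∈ U, a w u) * (1 - x w) + (∑ z ∈ W, a w z) / 2)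

/-- The total weight of the vertices of `S` not adjacent to `u`. -/
noncomputable def miss {V : Type*} (a : V → V → ℝ) (x : V → ℝ) (S : Finset V) (u : V) : ℝ :=
  ∑ w ∈ S, (1 - a u w) * x w

variable {V : Type*} {U W : Finset V} {a : V → V → ℝ} {x : V → ℝ} {ρ m r : ℝ}

lemma nonneg (h : PerronSplit U W a x ρ m r) (u v : V) : 0 ≤ a u v := by
  rcases h.zero_or_one u v with h | h <;> simp [h]

lemma entry_le_one (h : PerronSplit U W a x ρ m r) (u v : V) : a u v ≤ 1 := by
  rcases h.zero_or_one u v with h | h <;> simp [h]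

lemma rho_pos (h : PerronSplit U W a x ρ m r) : 0 < ρ := by
  linarith [h.one_le, h.large]

lemma miss_nonneg (h : PerronSplit U W a x ρ m r) (S : Finset V) (u : V) :
    0 ≤ miss a x S u :=
  Finset.sum_nonneg fun w _ =>
    mul_nonneg (by linarith [h.entry_le_one u w]) (h.pos w).le

lemma term_nonneg (h : PerronSplit U W a x ρ m r) (w : V) :
    0 ≤ (∑ u ∈ U, a w u) * (1 - x w) + (∑ z ∈ W, a w z) / 2 := by
  have h1 : 0 ≤ ∑ u ∈ U, a w u := Finset.sum_nonneg fun u _ => h.nonneg w u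
  have h2 : 0 ≤ ∑ z ∈ W, a w z := Finset.sum_nonneg fun u _ => h.nonneg w u
  have h3 := h.le_one w
  have := mul_nonneg h1 (sub_nonneg.2 h3)
  linarith

lemma sum_symm (h : PerronSplit U W a x ρ m r) (f : V → V → ℝ) :
    ∑ u ∈ U, ∑ v ∈ U, a u v * f u v = ∑ u ∈ U, ∑ v ∈ U, a u v * f v u := by
  rw [Finset.sum_comm]
  refine Finset.sum_congr rfl fun u _ => Finset.sum_congr rfl fun v _ => ?_
  rw [h.symm v u]

lemma loss_lt (h : PerronSplit U W a x ρ m r) :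
    loss U W a x < (∑ u ∈ U, ∑ v ∈ U, a u v * (x u + x v - 1)) / 2 + 1 := by
  have h1 : ρ ^ 2 = U.card + ∑ u ∈ U, ∑ v ∈ U, a u v * x v + ∑ u ∈ U, ∑ w ∈ W, a u w * x w := by
    rw [pow_two]
    nth_rewrite 2 [h.eig_top]
    rw [Finset.mul_sum, Finset.sum_congr rfl h.eig_U]
    simp [Finset.sum_add_distrib]
  have h2 : ∑ u ∈ U, ∑ v ∈ U, a u v * (x u + x v - 1)
      = 2 * ∑ u ∈ U, ∑ v ∈ U, a u v * x v - ∑ u ∈ U, ∑ v ∈ U, a u v := by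
    have := h.sum_symm (fun u _ => x u)
    simp only [mul_sub, mul_add, Finset.sum_add_distrib, Finset.sum_sub_distrib, mul_one]
    linarith
  have h3 : loss U W a x = ∑ u ∈ U, ∑ w ∈ W, a u w - ∑ u ∈ U, ∑ w ∈ W, a u w * x w
      + (∑ w ∈ W, ∑ z ∈ W, a w z) / 2 := by
    rw [Finset.sum_comm (s := U), Finset.sum_comm (s := U) (t := W) (f := fun u w => a u w * x w),
      loss, Finset.sum_add_distrib, Finset.sum_div, ← Finset.sum_sub_distrib]
    congr 1
    refine Finset.sum_congr rfl fun w _ => ?_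
    rw [← Finset.sum_mul, mul_sub, mul_one]
    simp only [h.symm w]
  have := h.edges
  have := h.edges_lt
  linarith

lemma inner_edges_le (h : PerronSplit U W a x ρ m r) :
    (∑ w ∈ W, ∑ z ∈ W, a w z) / 2 ≤ loss U W a x := by
  rw [loss, Finset.sum_add_distrib, Finset.sum_div]
  have : 0 ≤ ∑ w ∈ W, (∑ u ∈ U, a w u) * (1 - x w) :=
    Finset.sum_nonneg fun w _ => mul_nonneg (Finset.sum_nonneg fun u _ => h.nonneg w u)
      (sub_nonneg.2 (h.le_one w))
  linarith

lemma sum_edge_weight_le (h : PerronSplit U W a x ρ m r) :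
    ∑ u ∈ U, ∑ v ∈ U, a u v * x v ≤ r * ρ := by
  rw [h.sum_symm (fun _ v => x v), h.eig_top, Finset.mul_sum]
  refine Finset.sum_le_sum fun u hu => ?_
  rw [← Finset.sum_mul]
  exact mul_le_mul_of_nonneg_right (h.degree_le u hu) (h.pos u).le

lemma weight_le (h : PerronSplit U W a x ρ m r) :
    ρ * (1 + ∑ w ∈ W, x w) ≤ ρ ^ 2 + 1 + loss U W a x := by
  have h1 : ρ * (1 + ∑ w ∈ W, x w)
      = ∑ u ∈ U, x u + ∑ w ∈ W, ∑ u ∈ U, a w u * x u + ∑ w ∈ W, ∑ z ∈ W, a w z * x z := by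
    rw [mul_add, mul_one, Finset.mul_sum, Finset.sum_congr rfl h.eig_W, Finset.sum_add_distrib,
      ← h.eig_top]
    ring
  have h2 : ∑ u ∈ U, x u ≤ U.card := by
    simpa using Finset.sum_le_sum (s := U) fun u _ => h.le_one u
  have h3 : ∀ S : Finset V, ∑ w ∈ W, ∑ u ∈ S, a w u * x u ≤ ∑ w ∈ W, ∑ u ∈ S, a w u := fun S =>
    Finset.sum_le_sum fun w _ => Finset.sum_le_sum fun u _ =>
      mul_le_of_le_one_right (h.nonneg w u) (h.le_one u)
  have h4 : ∑ w ∈ W, ∑ u ∈ U, a w u = ∑ u ∈ U, ∑ w ∈ W, a u w := by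
    rw [Finset.sum_comm]
    simp only [h.symm]
  have h5 : 0 ≤ ∑ u ∈ U, ∑ v ∈ U, a u v :=
    Finset.sum_nonneg fun u _ => Finset.sum_nonneg fun v _ => h.nonneg u v
  have := h3 U
  have := h3 W
  have := h.edges
  have := h.edges_lt
  have := h.inner_edges_le
  linarith

lemma edge_le (h : PerronSplit U W a x ρ m r) {u v : V} (hu : u ∈ U) (hv : v ∈ U)
    (huv : a u v = 1) : ρ * (x u + x v) ≤ 3 * r + (1 + ∑ w ∈ W, x w) := by
  have h1 : ∀ u ∈ U, ∑ z ∈ U, a u z * x z ≤ r := fun u hu =>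
    (Finset.sum_le_sum fun z _ => mul_le_of_le_one_right (h.nonneg u z) (h.le_one z)).trans
      (h.degree_le u hu)
  have h2 : ∑ w ∈ W, a u w * x w + ∑ w ∈ W, a v w * x w
      ≤ ∑ w ∈ W, x w + ∑ w ∈ W, a u w * a v w := by
    rw [← Finset.sum_add_distrib, ← Finset.sum_add_distrib]
    refine Finset.sum_le_sum fun w _ => ?_
    have := h.le_one w
    have := h.pos w
    rcases h.zero_or_one u w with h1 | h1 <;> rcases h.zero_or_one v w with h2 | h2 <;>
      rw [h1, h2] <;> linarith
  have := h.book u hu v hv huv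
  have := h1 u hu
  have := h1 v hv
  have := h.eig_U u hu
  have := h.eig_U v hv
  linarith

lemma miss_add (h : PerronSplit U W a x ρ m r) {u v : V} (hu : u ∈ U) (hv : v ∈ U)
    (huv : a u v = 1) : 1 + ∑ w ∈ W, x w - r ≤ miss a x W u + miss a x W v := by
  have h2 : ∑ w ∈ W, x w - ∑ w ∈ W, a u w * a v w ≤ miss a x W u + miss a x W v := by
    rw [miss, miss, ← Finset.sum_add_distrib, ← Finset.sum_sub_distrib]
    refine Finset.sum_le_sum fun w _ => ?_
    have := h.le_one w
    have := h.pos w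
    rcases h.zero_or_one u w with h1 | h1 <;> rcases h.zero_or_one v w with h2 | h2 <;>
      rw [h1, h2] <;> linarith
  have := h.book u hu v hv huv
  linarith

lemma le_miss (h : PerronSplit U W a x ρ m r) {u : V} (hu : u ∈ U) :
    1 + ∑ w ∈ W, x w - ρ * x u ≤ miss a x W u := by
  have h1 : 0 ≤ ∑ v ∈ U, a u v * x v :=
    Finset.sum_nonneg fun v _ => mul_nonneg (h.nonneg u v) (h.pos v).le
  have h2 : miss a x W u = ∑ w ∈ W, x w - ∑ w ∈ W, a u w * x w := by
    simp only [miss, sub_mul, one_mul, Finset.sum_sub_distrib]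
  rw [h2, h.eig_U u hu]
  linarith

lemma term_ge (h : PerronSplit U W a x ρ m r) {w : V} (hw : w ∈ W) :
    x w * miss a x U w - (∑ z ∈ W, a w z) / 2
      ≤ (∑ u ∈ U, a w u) * (1 - x w) + (∑ z ∈ W, a w z) / 2 := by
  have h1 : ∀ S : Finset V, ∑ u ∈ S, a w u * x u ≤ ∑ u ∈ S, a w u := fun S =>
    Finset.sum_le_sum fun u _ => mul_le_of_le_one_right (h.nonneg w u) (h.le_one u)
  have h2 : miss a x U w = ρ - ∑ u ∈ U, a w u * x u := by
    simp only [miss, sub_mul, one_mul, Finset.sum_sub_distrib, ← h.eig_top]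
  have h3 := h.eig_W w hw
  have h4 := h1 U
  have h5 := h1 W
  have h6 := h.le_one w
  have h7 := h.pos w
  have h8 : (ρ * x w - ∑ z ∈ W, a w z) * (1 - x w) ≤ (∑ u ∈ U, a w u) * (1 - x w) :=
    mul_le_mul_of_nonneg_right (by linarith) (by linarith)
  have h9 : x w * (miss a x U w - ∑ z ∈ W, a w z) ≤ x w * (ρ * (1 - x w)) :=
    mul_le_mul_of_nonneg_left (by linarith) h7.le
  nlinarith

lemma sum_miss_comm (h : PerronSplit U W a x ρ m r) (S : Finset V) :
    ∑ w ∈ S, x w * miss a x U w = ∑ u ∈ U, x u * miss a x S u := by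
  simp only [miss, Finset.mul_sum]
  rw [Finset.sum_comm]
  refine Finset.sum_congr rfl fun u _ => Finset.sum_congr rfl fun v _ => ?_
  rw [h.symm v u]
  ring

lemma half_le_loss (h : PerronSplit U W a x ρ m r) :
    ∑ u ∈ U, x u * miss a x W u ≤ 2 * loss U W a x := by
  have h1 : ∑ w ∈ W, (x w * miss a x U w - (∑ z ∈ W, a w z) / 2) ≤ loss U W a x :=
    Finset.sum_le_sum fun w hw => h.term_ge hw
  rw [Finset.sum_sub_distrib, h.sum_miss_comm, ← Finset.sum_div] at h1
  linarith [h.inner_edges_le]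

lemma isolated_le_loss (h : PerronSplit U W a x ρ m r) :
    ∑ u ∈ U, x u * miss a x (W.filter fun w => ∑ z ∈ W, a w z = 0) u ≤ loss U W a x := by
  rw [← h.sum_miss_comm]
  refine (Finset.sum_le_sum fun w hw => ?_).trans
    (Finset.sum_le_sum_of_subset_of_nonneg (Finset.filter_subset _ _) fun w _ _ => h.term_nonneg w)
  obtain ⟨hw, h0⟩ := Finset.mem_filter.1 hw
  simpa [h0] using h.term_ge hw

lemma one_le_sum (h : PerronSplit U W a x ρ m r) {S : Finset V} {w : V}
    (h0 : ∑ z ∈ S, a w z ≠ 0) : 1 ≤ ∑ z ∈ S, a w z := by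
  obtain ⟨z, hz, hne⟩ := Finset.exists_ne_zero_of_sum_ne_zero h0
  have := (h.zero_or_one w z).resolve_left hne
  rw [← this]
  exact Finset.single_le_sum (f := fun z => a w z) (fun z _ => h.nonneg w z) hz

lemma miss_isolated (h : PerronSplit U W a x ρ m r) (u : V) :
    miss a x W u - ∑ w ∈ W, ∑ z ∈ W, a w z
      ≤ miss a x (W.filter fun w => ∑ z ∈ W, a w z = 0) u := by
  simp only [miss]
  rw [Finset.sum_filter, ← Finset.sum_sub_distrib]
  refine Finset.sum_le_sum fun w _ => ?_
  split_ifs with h0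
  · simp [h0]
  · have := h.one_le_sum h0
    have := h.nonneg u w
    have := h.le_one w
    have := h.pos w
    nlinarith

lemma sum_mul_miss_ge (h : PerronSplit U W a x ρ m r) (S : Finset V) :
    ∑ u ∈ U, miss a x S u
      + (∑ u ∈ U, ∑ v ∈ U, a u v * (miss a x S v * x u + miss a x S u * x v)) / 2
      ≤ ρ * ∑ u ∈ U, x u * miss a x S u := by
  have h1 : ∑ u ∈ U, ∑ v ∈ U, a u v * (miss a x S v * x u + miss a x S u * x v)
      = 2 * ∑ u ∈ U, miss a x S u * ∑ v ∈ U, a u v * x v := by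
    have := h.sum_symm (fun u v => miss a x S v * x u)
    simp only [mul_add, Finset.sum_add_distrib, Finset.mul_sum] at this ⊢
    rw [this, ← Finset.sum_add_distrib]
    refine Finset.sum_congr rfl fun u _ => ?_
    rw [← Finset.sum_add_distrib]
    refine Finset.sum_congr rfl fun v _ => ?_
    ring
  rw [h1, mul_div_cancel_left₀ _ two_ne_zero, ← Finset.sum_add_distrib, Finset.mul_sum]
  refine Finset.sum_le_sum fun u hu => ?_
  have h2 := h.eig_U u hu
  have h3 : 0 ≤ ∑ w ∈ W, a u w * x w :=
    Finset.sum_nonneg fun v _ => mul_nonneg (h.nonneg u v) (h.pos v).le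
  nlinarith [h.miss_nonneg S u]

lemma gain_le (h : PerronSplit U W a x ρ m r) {δ : ℝ} (hδ : 0 ≤ δ)
    (hy : 1 + ∑ w ∈ W, x w ≤ ρ + δ) :
    loss U W a x ≤ r * (3 * r + δ) + 1 := by
  have hρ := h.rho_pos
  have hr := h.one_le
  have h1 : ∑ u ∈ U, ∑ v ∈ U, a u v * (x u + x v - 1)
      ≤ ∑ u ∈ U, ∑ v ∈ U, a u v * ((3 * r + δ) / ρ * (x u + x v)) := by
    refine Finset.sum_le_sum fun u hu => Finset.sum_le_sum fun v hv => ?_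
    rcases h.zero_or_one u v with h0 | h0
    · simp [h0]
    · rw [h0, one_mul, one_mul]
      have h2 := h.edge_le hu hv h0
      have h3 : x u + x v - 1 ≤ (3 * r + δ) / ρ := by
        rw [le_div_iff₀ hρ]
        linarith
      have h4 : 0 ≤ (3 * r + δ) / ρ := by positivity
      have := h.pos u
      have := h.pos v
      by_cases h5 : x u + x v ≤ 1
      · have : 0 ≤ (3 * r + δ) / ρ * (x u + x v) := by positivity
        linarith
      · nlinarith
  have h2 : ∑ u ∈ U, ∑ v ∈ U, a u v * ((3 * r + δ) / ρ * (x u + x v))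
      = (3 * r + δ) / ρ * (2 * ∑ u ∈ U, ∑ v ∈ U, a u v * x v) := by
    have := h.sum_symm (fun u v => x u)
    simp only [mul_left_comm (a _ _), ← Finset.mul_sum, mul_add, Finset.sum_add_distrib]
    rw [this]
    ring
  have h3 := h.sum_edge_weight_le
  have h4 : (3 * r + δ) / ρ * (2 * ∑ u ∈ U, ∑ v ∈ U, a u v * x v)
      ≤ (3 * r + δ) / ρ * (2 * (r * ρ)) :=
    mul_le_mul_of_nonneg_left (by linarith) (by positivity)
  have h5 : (3 * r + δ) / ρ * (2 * (r * ρ)) = 2 * (r * (3 * r + δ)) := by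
    field_simp
  linarith [h.loss_lt]

lemma weight_le' (h : PerronSplit U W a x ρ m r) : 1 + ∑ w ∈ W, x w ≤ ρ + 0.03 * r := by
  have hρ := h.rho_pos
  have hr := h.one_le
  have hl := h.large
  have hw := h.weight_le
  have h0 : loss U W a x ≤ r * ρ + 1 := by
    have h1 := h.loss_lt
    have h2 : ∑ u ∈ U, ∑ v ∈ U, a u v * (x u + x v - 1)
        ≤ 2 * ∑ u ∈ U, ∑ v ∈ U, a u v * x v := by
      have := h.sum_symm (fun u _ => x u)
      have h5 : 0 ≤ ∑ u ∈ U, ∑ v ∈ U, a u v :=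
        Finset.sum_nonneg fun u _ => Finset.sum_nonneg fun v _ => h.nonneg u v
      simp only [mul_sub, mul_add, Finset.sum_add_distrib, Finset.sum_sub_distrib, mul_one]
      linarith
    linarith [h.sum_edge_weight_le]
  have h1 : 1 + ∑ w ∈ W, x w ≤ ρ + 1.01 * r := by
    refine le_of_mul_le_mul_left ?_ hρ
    nlinarith
  have h2 := h.gain_le (by positivity) h1
  refine le_of_mul_le_mul_left ?_ hρ
  nlinarith

lemma edge_le' (h : PerronSplit U W a x ρ m r) {u v : V} (hu : u ∈ U) (hv : v ∈ U)
    (huv : a u v = 1) : x u + x v - 1 ≤ 0.013 := by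
  have h1 := h.edge_le hu hv huv
  have h2 := h.weight_le'
  have := h.one_le
  have := h.large
  nlinarith [h.rho_pos]

lemma cross_ge (h : PerronSplit U W a x ρ m r) {u v : V} (hu : u ∈ U) (hv : v ∈ U)
    (huv : a u v = 1) {t : V → ℝ} {d : ℝ} (ht : ∀ u, miss a x W u - d ≤ t u) :
    (x u + x v) * (ρ * (x u + x v) / 2 - (3 * r + d)) ≤ t v * x u + t u * x v := by
  have h1 := h.edge_le hu hv huv
  have h2 := h.le_miss hu
  have h3 := h.le_miss hv
  have h4 := ht u
  have h5 := ht v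
  have h6 : (ρ * x u - (3 * r + d)) * x u ≤ t v * x u :=
    mul_le_mul_of_nonneg_right (by linarith) (h.pos u).le
  have h7 : (ρ * x v - (3 * r + d)) * x v ≤ t u * x v :=
    mul_le_mul_of_nonneg_right (by linarith) (h.pos v).le
  nlinarith [mul_nonneg h.rho_pos.le (sq_nonneg (x u - x v))]

lemma loss_le (h : PerronSplit U W a x ρ m r) : loss U W a x ≤ 9 / 8 := by
  have hρ := h.rho_pos
  have h1 := h.sum_mul_miss_ge W
  have h2 := h.half_le_loss
  have h3 := h.loss_lt
  have h4 : 0 ≤ ∑ u ∈ U, miss a x W u := Finset.sum_nonneg fun u _ => h.miss_nonneg W u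
  have h5 : ∑ u ∈ U, ∑ v ∈ U, 18 * ρ * (a u v * (x u + x v - 1))
      ≤ ∑ u ∈ U, ∑ v ∈ U, a u v * (miss a x W v * x u + miss a x W u * x v) := by
    refine Finset.sum_le_sum fun u hu => Finset.sum_le_sum fun v hv => ?_
    rcases h.zero_or_one u v with h0 | h0
    · simp [h0]
    · rw [h0, one_mul, one_mul]
      by_cases h5 : x u + x v ≤ 1
      · have h6 := mul_nonneg (h.miss_nonneg W v) (h.pos u).le
        have h7 := mul_nonneg (h.miss_nonneg W u) (h.pos v).le
        nlinarith
      · have h6 := h.edge_le' hu hv h0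
        have h7 := h.cross_ge hu hv h0 (t := miss a x W) (d := 0) (by simp)
        have h8 := h.large
        have h9 : 18 * ρ * (x u + x v - 1) ≤ 18 * ρ * 0.013 := by gcongr
        have h10 : ρ * 0.48 ≤ ρ * (x u + x v) / 2 - (3 * r + 0) := by nlinarith
        have h11 : ρ * 0.48 ≤ (x u + x v) * (ρ * (x u + x v) / 2 - (3 * r + 0)) := by nlinarith
        linarith
  simp only [← Finset.mul_sum] at h5
  have h6 : ρ * (9 * (∑ u ∈ U, ∑ v ∈ U, a u v * (x u + x v - 1))) ≤ ρ * (2 * loss U W a x) := by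
    nlinarith
  have h7 := le_of_mul_le_mul_left h6 hρ
  linarith

lemma edge_lt (h : PerronSplit U W a x ρ m r) {p q : V} (hp : p ∈ U) (hq : q ∈ U) (hpq : p ≠ q)
    (ha : a p q = 1) : x p + x q < 0.3 := by
  classical
  by_contra! hσ
  have hρ := h.rho_pos
  have hr := h.one_le
  have hl := h.large
  set S := W.filter fun w => ∑ z ∈ W, a w z = 0 with hS
  have ht : ∀ u, miss a x W u - 2.25 ≤ miss a x S u := fun u => by
    linarith [h.miss_isolated u, h.inner_edges_le, h.loss_le]
  have h1 := h.sum_mul_miss_ge S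
  have h2 := h.isolated_le_loss
  have h3 := h.loss_lt
  have h4 : miss a x S p + miss a x S q ≤ ∑ u ∈ U, miss a x S u := by
    rw [← Finset.sum_pair hpq]
    exact Finset.sum_le_sum_of_subset_of_nonneg (by simp [Finset.insert_subset_iff, hp, hq])
      fun u _ _ => h.miss_nonneg S u
  set K : V → V → ℝ := fun u v =>
    a u v * (miss a x S v * x u + miss a x S u * x v) - ρ * (a u v * (x u + x v - 1)) with hK
  have hK0 : ∀ u ∈ U, ∀ v ∈ U, 0 ≤ K u v := by
    intro u hu v hv
    simp only [hK]
    rcases h.zero_or_one u v with h0 | h0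
    · simp [h0]
    · rw [h0, one_mul, one_mul]
      by_cases h5 : x u + x v ≤ 1
      · have h6 := mul_nonneg (h.miss_nonneg S v) (h.pos u).le
        have h7 := mul_nonneg (h.miss_nonneg S u) (h.pos v).le
        nlinarith
      · have h6 := h.edge_le' hu hv h0
        have h7 := h.cross_ge hu hv h0 ht
        have h9 : ρ * (x u + x v - 1) ≤ ρ * 0.013 := by gcongr
        have h10 : ρ * 0.45 ≤ ρ * (x u + x v) / 2 - (3 * r + 2.25) := by nlinarith
        have h11 : ρ * 0.45 ≤ (x u + x v) * (ρ * (x u + x v) / 2 - (3 * r + 2.25)) := by nlinarith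
        linarith
  have h5 : K p q + K q p ≤ ∑ u ∈ U, ∑ v ∈ U, K u v := by
    have h6 : ∀ u ∈ U, 0 ≤ ∑ v ∈ U, K u v := fun u hu => Finset.sum_nonneg fun v hv => hK0 u hu v hv
    calc K p q + K q p ≤ ∑ v ∈ U, K p v + ∑ v ∈ U, K q v :=
          add_le_add (Finset.single_le_sum (f := fun v => K p v) (fun v hv => hK0 p hp v hv) hq)
            (Finset.single_le_sum (f := fun v => K q v) (fun v hv => hK0 q hq v hv) hp)
      _ = ∑ u ∈ {p, q}, ∑ v ∈ U, K u v :=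
          (Finset.sum_pair (f := fun u => ∑ v ∈ U, K u v) hpq).symm
      _ ≤ _ := Finset.sum_le_sum_of_subset_of_nonneg
          (by simp [Finset.insert_subset_iff, hp, hq]) fun u hu _ => h6 u hu
  have h6 : ∑ u ∈ U, ∑ v ∈ U, K u v
      = ∑ u ∈ U, ∑ v ∈ U, a u v * (miss a x S v * x u + miss a x S u * x v)
        - ρ * ∑ u ∈ U, ∑ v ∈ U, a u v * (x u + x v - 1) := by
    simp only [hK, Finset.sum_sub_distrib, Finset.mul_sum]
  have h7 : K q p = K p q := by
    simp only [hK, h.symm q p]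
    ring
  have h8 : K p q = (miss a x S q * x p + miss a x S p * x q) - ρ * (x p + x q - 1) := by
    simp only [hK, ha, one_mul]
  have h9 := h.cross_ge hp hq ha ht
  have h10 := h.miss_add hp hq ha
  have h11 := h.edge_le hp hq ha
  have h12 := ht p
  have h13 := ht q
  have h14 : ρ * ∑ u ∈ U, x u * miss a x S u
      < ρ * ((∑ u ∈ U, ∑ v ∈ U, a u v * (x u + x v - 1)) / 2 + 1) :=
    mul_lt_mul_of_pos_left (h2.trans_lt h3) hρ
  have h15 : ρ * 0.1279 ≤ ρ * (x p + x q) / 2 - (3 * r + 2.25) := by nlinarith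
  have h16 : 0.3 * (ρ * 0.1279) ≤ (x p + x q) * (ρ * (x p + x q) / 2 - (3 * r + 2.25)) := by
    refine mul_le_mul hσ h15 (by positivity) (by linarith)
  linarith

lemma loss_lt_of_edge (h : PerronSplit U W a x ρ m r) (hirr : ∀ v, a v v = 0)
    (E : Finset (V × V)) (hE : ∀ e ∈ E, e.1 ∈ U ∧ e.2 ∈ U ∧ a e.1 e.2 = 1) :
    loss U W a x < 1 - 0.35 * E.card := by
  have h1 : ∑ u ∈ U, ∑ v ∈ U, a u v * (x u + x v - 1) ≤ -0.7 * E.card := by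
    rw [← Finset.sum_product' (f := fun u v => a u v * (x u + x v - 1))]
    have h2 : ∀ u ∈ U, ∀ v ∈ U, a u v * (x u + x v - 1) ≤ -0.7 * a u v := by
      intro u hu v hv
      rcases h.zero_or_one u v with h0 | h0
      · simp [h0]
      · have hne : u ≠ v := by
          rintro rfl
          simp [hirr] at h0
        have := h.edge_lt hu hv hne h0
        rw [h0]
        linarith
    have h3 : (E.card : ℝ) ≤ ∑ e ∈ U ×ˢ U, a e.1 e.2 := by
      calc (E.card : ℝ) = ∑ e ∈ E, a e.1 e.2 := by
            rw [Finset.sum_congr rfl fun e he => (hE e he).2.2]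
            simp
        _ ≤ _ := Finset.sum_le_sum_of_subset_of_nonneg
            (fun e he => Finset.mem_product.2 ⟨(hE e he).1, (hE e he).2.1⟩)
            fun e _ _ => h.nonneg _ _
    have h4 : ∑ e ∈ U ×ˢ U, a e.1 e.2 * (x e.1 + x e.2 - 1) ≤ ∑ e ∈ U ×ˢ U, -0.7 * a e.1 e.2 :=
      Finset.sum_le_sum fun e he => h2 _ (Finset.mem_product.1 he).1 _ (Finset.mem_product.1 he).2
    rw [← Finset.mul_sum] at h4
    linarith
  linarith [h.loss_lt]

lemma inner_edge_one_le (h : PerronSplit U W a x ρ m r) (hirr : ∀ v, a v v = 0) {w z : V}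
    (hw : w ∈ W) (hz : z ∈ W) (hwz : a w z = 1) : 1 ≤ loss U W a x := by
  classical
  have hne : w ≠ z := by
    rintro rfl
    simp [hirr] at hwz
  have h1 : ∀ w ∈ W, ∀ z ∈ W, a w z = 1 → 1 ≤ ∑ z ∈ W, a w z := fun w _ z hz hwz => by
    rw [← hwz]
    exact Finset.single_le_sum (f := fun z => a w z) (fun z _ => h.nonneg w z) hz
  have h2 : ∑ y ∈ {w, z}, ∑ z ∈ W, a y z ≤ ∑ w ∈ W, ∑ z ∈ W, a w z :=
    Finset.sum_le_sum_of_subset_of_nonneg (by simp [Finset.insert_subset_iff, hw, hz])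
      fun w _ _ => Finset.sum_nonneg fun z _ => h.nonneg w z
  rw [Finset.sum_pair hne] at h2
  have := h1 w hw z hz hwz
  have := h1 z hz w hw (by rw [h.symm, hwz])
  linarith [h.inner_edges_le]

lemma weight_near_one (h : PerronSplit U W a x ρ m r) (hL : loss U W a x < 0.3)
    (hW : ∀ w ∈ W, ∀ z ∈ W, a w z = 0) {w : V} (hw : w ∈ W) : 238 / 239 ≤ x w := by
  have hρ := h.rho_pos
  have hr := h.one_le
  have hl := h.large
  have h1 : (∑ u ∈ U, a w u) * (1 - x w) ≤ loss U W a x := by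
    have h2 := Finset.single_le_sum
      (f := fun w => (∑ u ∈ U, a w u) * (1 - x w) + (∑ z ∈ W, a w z) / 2)
      (fun w _ => h.term_nonneg w) hw
    have h3 : ∑ z ∈ W, a w z = 0 := Finset.sum_eq_zero fun z hz => hW w hw z hz
    simp only [h3, zero_div, add_zero] at h2
    exact h2
  have h2 : ρ * x w ≤ ∑ u ∈ U, a w u := by
    rw [h.eig_W w hw, Finset.sum_eq_zero (s := W) fun z hz => by rw [hW w hw z hz, zero_mul],
      add_zero]
    exact Finset.sum_le_sum fun u _ => mul_le_of_le_one_right (h.nonneg w u) (h.le_one u)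
  have hx := h.pos w
  have hx1 := h.le_one w
  have h3 : 1 ≤ ∑ u ∈ U, a w u := h.one_le_sum (by have := mul_pos hρ hx; linarith)
  have h4 : 0.7 ≤ x w := by nlinarith
  have h5 : 167.3 * (1 - x w) ≤ (∑ u ∈ U, a w u) * (1 - x w) :=
    mul_le_mul_of_nonneg_right (by nlinarith) (by linarith)
  linarith

lemma adj_of_loss_lt (h : PerronSplit U W a x ρ m r) (hL : loss U W a x < 0.3)
    (hW : ∀ w ∈ W, ∀ z ∈ W, a w z = 0)
    (hx : ∀ u ∈ U, ρ * x u ≤ W.card + 2) {u : V} (hu : u ∈ U) {w : V} (hw : w ∈ W) :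
    a u w = 1 := by
  by_contra hne
  have h0 : a u w = 0 := (h.zero_or_one u w).resolve_right hne
  have hρ := h.rho_pos
  set A : ℝ := (W.card : ℝ) with hA
  have hA1 : 1 ≤ A := by
    rw [hA]
    exact_mod_cast Finset.card_pos.2 ⟨w, hw⟩
  set p : ℝ := ∑ z ∈ W, (1 - a u z) with hp
  have hp1 : 1 ≤ p := by
    have := Finset.single_le_sum (f := fun z => 1 - a u z)
      (fun z _ => sub_nonneg.2 (h.entry_le_one u z)) hw
    rwa [h0, sub_zero] at this
  have hpA : p = A - ∑ z ∈ W, a u z := by simp [hp, hA, Finset.sum_sub_distrib]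
  have hsum : 0 ≤ ∑ z ∈ W, a u z := Finset.sum_nonneg fun z _ => h.nonneg u z
  have h1 : ∀ z ∈ W, 238 / 239 ≤ x z := fun z hz => h.weight_near_one hL hW hz
  have hxu : 238 / 239 * (A - p + 1) ≤ ρ * x u := by
    have h2 : 238 / 239 * ∑ z ∈ W, a u z ≤ ∑ z ∈ W, a u z * x z := by
      rw [Finset.mul_sum]
      refine Finset.sum_le_sum fun z hz => ?_
      nlinarith [h.nonneg u z, h1 z hz]
    have h3 : 0 ≤ ∑ v ∈ U, a u v * x v :=
      Finset.sum_nonneg fun v _ => mul_nonneg (h.nonneg u v) (h.pos v).le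
    rw [h.eig_U u hu, hpA]
    linarith
  have hterm : ∀ z ∈ W, (1 - a u z) * (238 / 239 * (ρ * x u))
      ≤ (A + 2) * ((∑ v ∈ U, a z v) * (1 - x z) + (∑ y ∈ W, a z y) / 2) := by
    intro z hz
    have h3 : ∑ y ∈ W, a z y = 0 := Finset.sum_eq_zero fun y hy => hW z hz y hy
    have h4 : ρ * x z = ∑ v ∈ U, a z v * x v := by
      rw [h.eig_W z hz, Finset.sum_eq_zero (s := W) fun y hy => by rw [hW z hz y hy, zero_mul],
        add_zero]
    have h5 : ρ * (ρ * x z) ≤ (A + 2) * ∑ v ∈ U, a z v := by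
      rw [h4, Finset.mul_sum, Finset.mul_sum]
      refine Finset.sum_le_sum fun v hv => ?_
      nlinarith [h.nonneg z v, hx v hv]
    have h6 : (1 - a u z) * x u ≤ ρ * (1 - x z) := by
      have h7 : ρ * (1 - x z) = miss a x U z := by
        simp only [miss, sub_mul, one_mul, Finset.sum_sub_distrib, ← h.eig_top, ← h4]
        ring
      rw [h7, h.symm u z]
      exact Finset.single_le_sum (f := fun v => (1 - a z v) * x v)
        (fun v _ => mul_nonneg (sub_nonneg.2 (h.entry_le_one z v)) (h.pos v).le) hu
    have hxz := h1 z hz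
    have hxz1 := h.le_one z
    rw [h3, zero_div, add_zero]
    calc (1 - a u z) * (238 / 239 * (ρ * x u)) = 238 / 239 * (ρ * ((1 - a u z) * x u)) := by ring
      _ ≤ x z * (ρ * ((1 - a u z) * x u)) :=
          mul_le_mul_of_nonneg_right hxz (mul_nonneg hρ.le
            (mul_nonneg (sub_nonneg.2 (h.entry_le_one u z)) (h.pos u).le))
      _ ≤ x z * (ρ * (ρ * (1 - x z))) := by
          have := h.pos z
          gcongr
      _ = ρ * (ρ * x z) * (1 - x z) := by ring
      _ ≤ (A + 2) * (∑ v ∈ U, a z v) * (1 - x z) :=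
          mul_le_mul_of_nonneg_right h5 (by linarith)
      _ = _ := by ring
  have h2 := Finset.sum_le_sum hterm
  rw [← Finset.sum_mul, ← Finset.mul_sum, ← hp] at h2
  change _ ≤ (A + 2) * loss U W a x at h2
  have h3 : p * (238 / 239 * (238 / 239 * (A - p + 1))) ≤ p * (238 / 239 * (ρ * x u)) := by
    gcongr
  have h4 : A ≤ p * (A - p + 1) := by nlinarith
  nlinarith

end PerronSplit

/-- Under the section-3 hypotheses, if `G` is moreover non-bipartite then there is exactly one edge `u₁u₂` of `G` inside `U`, every vertex of `W` is adjacent to both `u₁` and `u₂`, and `x_u ≤ ((|W| + 2)/ρ) x_{u*}` for every `u ∈ U`. -/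
theorem final_structure
    {V : Type*} [Fintype V] [DecidableEq V]
    (G : SimpleGraph V) [DecidableRel G.Adj] (hconn : G.Connected)
    (r : ℕ) (hr : 1 ≤ r)
    (hfree : ∀ u v, G.Adj u v → (G.neighborFinset u ∩ G.neighborFinset v).card ≤ r)
    (hm : 1 ≤ G.edgeFinset.card)
    (ρ : ℝ) (x : V → ℝ) (hx : ∀ v, 0 < x v)
    (heig : (G.adjMatrix ℝ).mulVec x = ρ • x)
    (ustar : V) (hustar : ∀ v, x v ≤ x ustar)
    (U W Wstar : Finset V)
    (hU : U = G.neighborFinset ustar)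
    (hW : W = Finset.univ \ insert ustar U)
    (hWstar : Wstar = W.filter (fun w => (1 - 4.5 * r / ρ) * x ustar ≤ x w))
    (hm2 : (240 * r) ^ 2 ≤ G.edgeFinset.card)
    (hρ2 : (G.edgeFinset.card : ℝ) - 1 + 2 / (ρ - 1) ≤ ρ ^ 2)
    (hnb : ¬ G.Colorable 2)
    :
    ∃ u₁ u₂, u₁ ∈ U ∧ u₂ ∈ U ∧ G.Adj u₁ u₂ ∧
      (∀ v w, v ∈ U → w ∈ U → G.Adj v w → (v = u₁ ∧ w = u₂) ∨ (v = u₂ ∧ w = u₁)) ∧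
      (∀ w ∈ W, G.Adj w u₁ ∧ G.Adj w u₂) ∧
      (∀ u ∈ U, x u ≤ ((W.card + 2 : ℝ) / ρ) * x ustar) := by
  have hx0 := hx ustar
  have hsplit : ∀ f : V → ℝ, ∑ v, f v = f ustar + ∑ u ∈ U, f u + ∑ w ∈ W, f w := by
    intro f
    have hn : ustar ∉ U := by simp [hU]
    rw [← Finset.sum_insert hn, hW, add_comm, Finset.sum_sdiff (Finset.subset_univ _)]
  set a : V → V → ℝ := fun u v => if G.Adj u v then 1 else 0 with ha
  have ha1 : ∀ u v, a u v = 1 ↔ G.Adj u v := fun u v => by simp [ha]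
  have hirr : ∀ v, a v v = 0 := fun v => by simp [ha]
  have hsymm : ∀ u v, a u v = a v u := fun u v => by simp only [ha, G.adj_comm]
  have hUtop : ∀ u ∈ U, a u ustar = 1 := fun u hu => by
    rw [hU, SimpleGraph.mem_neighborFinset] at hu
    exact (ha1 _ _).2 hu.symm
  have hWtop : ∀ w ∈ W, a w ustar = 0 := fun w hw => by
    simp only [hW, hU, Finset.mem_sdiff, Finset.mem_insert, SimpleGraph.mem_neighborFinset,
      not_or] at hw
    exact if_neg fun h => hw.2.2 (SimpleGraph.Adj.symm h)
  have hcodeg : ∀ u v, ∑ z, a u z * a v z = (G.neighborFinset u ∩ G.neighborFinset v).card := by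
    intro u v
    simp only [ha, ← ite_and, mul_ite, mul_one, mul_zero]
    rw [Finset.sum_boole]
    congr 2
    ext z
    simp [and_comm]
  have hbook : ∀ u v, a u v = 1 → ∑ z, a u z * a v z ≤ r := fun u v h => by
    rw [hcodeg]
    exact_mod_cast hfree u v ((ha1 u v).1 h)
  have heig' : ∀ v, ρ * (x v / x ustar) = ∑ z, a v z * (x z / x ustar) := by
    intro v
    have h1 := congrFun heig v
    simp only [Matrix.mulVec, dotProduct, SimpleGraph.adjMatrix_apply, Pi.smul_apply,
      smul_eq_mul] at h1
    rw [← mul_div_assoc, ← h1, Finset.sum_div]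
    exact Finset.sum_congr rfl fun z _ => mul_div_assoc _ _ _
  have hx1 : x ustar / x ustar = 1 := div_self hx0.ne'
  have hpos : ∀ v, 0 < x v / x ustar := fun v => div_pos (hx v) hx0
  have hle : ∀ v, x v / x ustar ≤ 1 := fun v => (div_le_one hx0).2 (hustar v)
  have ha0 : ∀ u v, 0 ≤ a u v := fun u v => by
    simp only [ha]
    split_ifs <;> norm_num
  have hdeg : ∀ v, ∑ z, a v z = G.degree v := fun v => by
    simp only [ha]
    rw [Finset.sum_boole, ← SimpleGraph.card_neighborFinset_eq_degree]
    congr 2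
    ext z
    simp
  have hedges : 2 * (G.edgeFinset.card : ℝ) = ∑ v, ∑ z, a v z := by
    simp only [hdeg]
    exact_mod_cast (G.sum_degrees_eq_twice_card_edges).symm
  have htopU : ∀ f : V → ℝ, ∑ u ∈ U, a ustar u * f u = ∑ u ∈ U, f u := fun f =>
    Finset.sum_congr rfl fun u hu => by rw [hsymm, hUtop u hu, one_mul]
  have htopW : ∀ f : V → ℝ, ∑ w ∈ W, a ustar w * f w = 0 := fun f =>
    Finset.sum_eq_zero fun w hw => by rw [hsymm, hWtop w hw, zero_mul]
  have hrho : 1 ≤ ρ := by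
    obtain ⟨e, he⟩ := Finset.card_pos.1 hm
    have hne : U.Nonempty := by
      by_contra hne
      rw [Finset.not_nonempty_iff_eq_empty] at hne
      have h1 := heig' ustar
      rw [hsplit, htopU, htopW, hne, hirr, hx1] at h1
      simp only [mul_one, Finset.sum_empty, add_zero] at h1
      induction e using Sym2.ind with
      | _ p q =>
        rw [SimpleGraph.mem_edgeFinset, SimpleGraph.mem_edgeSet] at he
        have h2 := heig' p
        have h3 := Finset.single_le_sum (f := fun z => a p z * (x z / x ustar))
          (fun z _ => mul_nonneg (ha0 p z) (hpos z).le) (Finset.mem_univ q)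
        simp only [(ha1 p q).2 he, one_mul] at h3
        rw [h1, zero_mul] at h2
        linarith [hpos q]
    obtain ⟨u, hu⟩ := hne
    have h2 := heig' u
    have h3 := Finset.single_le_sum (f := fun z => a u z * (x z / x ustar))
      (fun z _ => mul_nonneg (ha0 u z) (hpos z).le) (Finset.mem_univ ustar)
    simp only [hUtop u hu, one_mul, hx1] at h3
    nlinarith [hpos u, hle u]
  have hr' : (1 : ℝ) ≤ r := by exact_mod_cast hr
  have hm2' : (240 * (r : ℝ)) ^ 2 ≤ G.edgeFinset.card := by exact_mod_cast hm2
  have hrho' : 1 < ρ := by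
    refine lt_of_le_of_ne hrho fun h => ?_
    rw [← h] at hρ2
    norm_num at hρ2
    nlinarith
  have hfrac : 0 < 2 / (ρ - 1) := div_pos two_pos (by linarith)
  have H : PerronSplit U W a (fun v => x v / x ustar) ρ G.edgeFinset.card r :=
    { zero_or_one := fun u v => by
        simp only [ha]
        split_ifs <;> simp
      symm := hsymm
      pos := hpos
      le_one := hle
      eig_top := by
        have h1 := heig' ustar
        rw [hsplit, htopU, htopW, hirr, hx1] at h1
        linarith
      eig_U := fun u hu => by
        rw [heig', hsplit, hUtop u hu, hx1, mul_one]
      eig_W := fun w hw => by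
        rw [heig', hsplit, hWtop w hw, zero_mul, zero_add]
      edges := by
        have h1 := hedges
        have h2 := htopU 1
        have h3 := htopW 1
        have h4 : ∑ w ∈ W, ∑ u ∈ U, a w u = ∑ u ∈ U, ∑ w ∈ W, a u w := by
          rw [Finset.sum_comm]
          simp only [hsymm]
        have h5 := Finset.sum_congr rfl hUtop
        have h6 := Finset.sum_eq_zero hWtop
        simp only [Pi.one_apply, mul_one, Finset.sum_const, nsmul_eq_mul] at h2 h3 h5
        simp only [hsplit, Finset.sum_add_distrib, hirr, h2, h3, h4, h5, h6] at h1
        linarith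
      degree_le := fun u hu => by
        have h1 := hbook ustar u (by rw [hsymm, hUtop u hu])
        rw [hsplit, htopU, htopW, hirr] at h1
        linarith
      book := fun u hu v hv huv => by
        have h1 := hbook u v huv
        rw [hsplit, hUtop u hu, hUtop v hv] at h1
        have h2 : 0 ≤ ∑ z ∈ U, a u z * a v z :=
          Finset.sum_nonneg fun z _ => mul_nonneg (ha0 u z) (ha0 v z)
        linarith
      one_le := hr'
      large := by
        by_contra! h
        nlinarith
      edges_lt := by linarith }
  have hWind : ∀ w ∈ W, ∀ z ∈ W, PerronSplit.loss U W a (fun v => x v / x ustar) < 1 →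
      ¬ G.Adj w z := fun w hw z hz hlt hwz =>
    absurd (H.inner_edge_one_le hirr hw hz ((ha1 w z).2 hwz)) (not_le.2 hlt)
  have hex : ∃ u₁ ∈ U, ∃ u₂ ∈ U, G.Adj u₁ u₂ := by
    by_contra! hno
    have hlt := H.loss_lt_of_edge hirr ∅ (by simp)
    simp only [Finset.card_empty, Nat.cast_zero, mul_zero, sub_zero] at hlt
    refine hnb ⟨SimpleGraph.Coloring.mk (fun v => if v ∈ U then (0 : Fin 2) else 1) ?_⟩
    intro v w hvw
    have hside : ∀ v, v ∉ U → v ≠ ustar → v ∈ W := fun v h1 h2 => by simp [hW, h1, h2]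
    have htop : ∀ v, G.Adj ustar v → v ∈ U := fun v h => by simpa [hU] using h
    by_cases hv : v ∈ U <;> by_cases hw : w ∈ U
    · exact absurd hvw (hno v hv w hw)
    · simp [hv, hw]
    · simp [hv, hw]
    · refine absurd hvw (hWind v (hside v hv ?_) w (hside w hw ?_) hlt)
      · rintro rfl
        exact hw (htop w hvw)
      · rintro rfl
        exact hv (htop v hvw.symm)
  obtain ⟨u₁, hu₁, u₂, hu₂, hadj⟩ := hex
  have hne : u₁ ≠ u₂ := hadj.ne
  have huniq : ∀ v w, v ∈ U → w ∈ U → G.Adj v w → (v = u₁ ∧ w = u₂) ∨ (v = u₂ ∧ w = u₁) := by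
    intro v w hv hw hvw
    by_contra hcon
    have h1 := H.loss_lt_of_edge hirr {(u₁, u₂), (u₂, u₁), (v, w)} (by
      simp [ha1, hu₁, hu₂, hv, hw, hadj, hadj.symm, hvw])
    have h2 : ({(u₁, u₂), (u₂, u₁), (v, w)} : Finset (V × V)).card = 3 := by
      rw [Finset.card_eq_three]
      refine ⟨_, _, _, ?_, ?_, ?_, rfl⟩ <;> simp only [ne_eq, Prod.mk.injEq] <;> grind
    rw [h2] at h1
    have h3 : 0 ≤ PerronSplit.loss U W a (fun v => x v / x ustar) :=
      Finset.sum_nonneg fun w _ => H.term_nonneg w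
    norm_num at h1
    linarith
  have hL : PerronSplit.loss U W a (fun v => x v / x ustar) < 0.3 := by
    have h1 := H.loss_lt_of_edge hirr {(u₁, u₂), (u₂, u₁)} (by
      simp [ha1, hu₁, hu₂, hadj, hadj.symm])
    rw [Finset.card_pair (by simp [hne])] at h1
    norm_num at h1 ⊢
    linarith
  have hW0 : ∀ w ∈ W, ∀ z ∈ W, a w z = 0 := fun w hw z hz =>
    (H.zero_or_one w z).resolve_right fun h =>
      hWind w hw z hz (hL.trans (by norm_num)) ((ha1 w z).1 h)
  have hbound : ∀ u ∈ U, ρ * (x u / x ustar) ≤ W.card + 2 := by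
    intro u hu
    have h1 : ∑ v ∈ U, a u v ≤ 1 := by
      simp only [ha]
      rw [Finset.sum_boole, Nat.cast_le_one, Finset.card_le_one]
      intro v hv w hw
      rw [Finset.mem_filter] at hv hw
      have h2 := huniq u v hu hv.1 hv.2
      have h3 := huniq u w hu hw.1 hw.2
      grind
    have h2 : ∑ v ∈ U, a u v * (x v / x ustar) ≤ ∑ v ∈ U, a u v :=
      Finset.sum_le_sum fun v _ => mul_le_of_le_one_right (ha0 u v) (hle v)
    have h3 : ∑ w ∈ W, a u w * (x w / x ustar) ≤ W.card := by
      have h4 := Finset.sum_le_sum (s := W) fun w _ =>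
        mul_le_one₀ (H.entry_le_one u w) (hpos w).le (hle w)
      simpa using h4
    have h4 := H.eig_U u hu
    linarith
  have hfull : ∀ u ∈ U, ∀ w ∈ W, G.Adj w u := fun u hu w hw =>
    ((ha1 u w).1 (H.adj_of_loss_lt hL hW0 hbound hu hw)).symm
  refine ⟨u₁, u₂, hu₁, hu₂, hadj, huniq, fun w hw => ⟨hfull u₁ hu₁ w hw, hfull u₂ hu₂ w hw⟩,
    fun u hu => ?_⟩
  rw [← div_le_iff₀ hx0, le_div_iff₀ H.rho_pos, mul_comm]
  exact hbound u hu

end PerronSetup
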